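/- Let d ≥ 1 and, for i, j ∈ {0, 1, …, d}, let E_{i,j} denote the (d+1)×(d+1) elementary matrices, and set H_i = E_{i−1,i−1} − E_{i,i} for i ∈ {1, …, d}. Let s_i, r_i : [0,∞) → ℝ be continuously differentiable and u_i : [0,∞) → ℝ continuous (i = 1, …, d), define L(t) = Σ_{i=1}^d s_i(t) H_i + Σ_{i=1}^d r_i(t)(E_{i−1,i} + E_{i,i−1}) and M(t) = Σ_{i=1}^d u_i(t)(E_{i−1,i} − E_{i,i−1}), and assume that u_i(t) ≠ 0 and r_i(t) ≠ 0 for all i and t and that r_{i−1}(t)/r_i(t) = u_{i−1}(t)/u_i(t) for all i ∈ {2, …, d} and all t. Then the Lax equation L̇(t) = [M(t), L(t)] holds for all t if and only if, for all t, ṡ_i(t) = 2 r_i(t) u_i(t) for i ∈ {1, …, d} and ṙ_i(t) = u_i(t)(s_{i−1}(t) − 2 s_i(t) + s_{i+1}(t)) for i ∈ {1, …, d}, with the convention s_0(t) = s_{d+1}(t) = 0. -/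

import Mathlib

open Fin.NatCast in
/-- The elementary (d+1)×(d+1) matrix E_{i,j} (indices taken mod d+1). -/
noncomputable def elemE (d : ℕ) (i j : ℕ) : Matrix (Fin (d + 1)) (Fin (d + 1)) ℝ :=
  Matrix.single (i : Fin (d + 1)) (j : Fin (d + 1)) 1

/-- The Lax operator L(t) = Σ s_i(t) H_i + Σ r_i(t)(E_{i−1,i} + E_{i,i−1}) of
𝔰𝔩(d+1), with H_i = E_{i−1,i−1} − E_{i,i}. -/
noncomputable def laxL (d : ℕ) (s r : ℕ → ℝ → ℝ) (t : ℝ) :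
    Matrix (Fin (d + 1)) (Fin (d + 1)) ℝ :=
  (∑ i ∈ Finset.Icc 1 d, s i t • (elemE d (i - 1) (i - 1) - elemE d i i))
    + ∑ i ∈ Finset.Icc 1 d, r i t • (elemE d (i - 1) i + elemE d i (i - 1))

/-- The operator M(t) = Σ u_i(t)(E_{i−1,i} − E_{i,i−1}) of 𝔰𝔩(d+1). -/
noncomputable def laxM (d : ℕ) (u : ℕ → ℝ → ℝ) (t : ℝ) :
    Matrix (Fin (d + 1)) (Fin (d + 1)) ℝ :=
  ∑ i ∈ Finset.Icc 1 d, u i t • (elemE d (i - 1) i - elemE d i (i - 1))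

/-- The sequence `x` cut off to the indices `1, …, d`. -/
noncomputable def cutoff (d : ℕ) (x : ℕ → ℝ) (k : ℕ) : ℝ :=
  if k ∈ Finset.Icc 1 d then x k else 0

theorem cutoff_of_mem {d k : ℕ} (x : ℕ → ℝ) (hk : k ∈ Finset.Icc 1 d) :
    cutoff d x k = x k :=
  if_pos hk

theorem cutoff_of_notMem {d k : ℕ} (x : ℕ → ℝ) (hk : k ∉ Finset.Icc 1 d) :
    cutoff d x k = 0 :=
  if_neg hk

theorem cutoff_zero (d : ℕ) (x : ℕ → ℝ) : cutoff d x 0 = 0 :=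
  cutoff_of_notMem x (by simp)

theorem elemE_apply {d k l : ℕ} (hk : k ≤ d) (hl : l ≤ d) (i j : Fin (d + 1)) :
    elemE d k l i j = if k = i ∧ l = j then 1 else 0 := by
  simp only [elemE, Matrix.single_apply, Fin.ext_iff, Fin.val_natCast,
    Nat.mod_eq_of_lt (Nat.lt_succ_of_le hk), Nat.mod_eq_of_lt (Nat.lt_succ_of_le hl)]

/-- A sum over `1, …, d` whose coefficients select the single index `c`, provided `p` holds. -/
theorem sum_Icc_mul_eq_cutoff {d : ℕ} (x f : ℕ → ℝ) (c : ℕ) (p : Prop) [Decidable p]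
    (hf : ∀ k ∈ Finset.Icc 1 d, f k = if k = c ∧ p then 1 else 0) :
    ∑ k ∈ Finset.Icc 1 d, x k * f k = if p then cutoff d x c else 0 := by
  rw [Finset.sum_congr rfl fun k hk => by rw [hf k hk]]
  by_cases hp : p <;> simp [hp, cutoff]

/-- The entries of the symmetric tridiagonal matrix `∑ a_k H_k + ∑ b_k (E_{k-1,k} + E_{k,k-1})`. -/
noncomputable def jacobiEntry (a b : ℕ → ℝ) (i j : ℕ) : ℝ :=
  (if i = j then a (i + 1) - a i else 0) + (if j = i + 1 then b j else 0)
    + (if i = j + 1 then b i else 0)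

theorem jacobiEntry_comm (a b : ℕ → ℝ) (i j : ℕ) :
    jacobiEntry a b i j = jacobiEntry a b j i := by
  grind [jacobiEntry]

theorem sum_smul_elemE_apply (d : ℕ) (a b : ℕ → ℝ) (i j : Fin (d + 1)) :
    ((∑ k ∈ Finset.Icc 1 d, a k • (elemE d (k - 1) (k - 1) - elemE d k k))
      + ∑ k ∈ Finset.Icc 1 d, b k • (elemE d (k - 1) k + elemE d k (k - 1))) i j
      = jacobiEntry (cutoff d a) (cutoff d b) i j := by
  simp only [Matrix.add_apply, Matrix.sum_apply, Matrix.smul_apply, Matrix.sub_apply, smul_eq_mul,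
    mul_sub, mul_add, Finset.sum_sub_distrib, Finset.sum_add_distrib]
  rw [sum_Icc_mul_eq_cutoff a _ (i + 1) ((i : ℕ) = j), sum_Icc_mul_eq_cutoff a _ i ((i : ℕ) = j),
    sum_Icc_mul_eq_cutoff b _ j ((j : ℕ) = i + 1), sum_Icc_mul_eq_cutoff b _ i ((i : ℕ) = j + 1)]
  · unfold jacobiEntry
    split_ifs <;> ring
  all_goals
    intro k hk
    rw [Finset.mem_Icc] at hk
    rw [elemE_apply (by omega) (by omega)]
    congr 1
    apply propext
    omega

theorem laxL_apply (d : ℕ) (s r : ℕ → ℝ → ℝ) (t : ℝ) (i j : Fin (d + 1)) :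
    laxL d s r t i j
      = jacobiEntry (cutoff d fun k => s k t) (cutoff d fun k => r k t) i j :=
  sum_smul_elemE_apply d _ _ i j

theorem laxM_apply (d : ℕ) (u : ℕ → ℝ → ℝ) (t : ℝ) (i j : Fin (d + 1)) :
    laxM d u t i j = (if (j : ℕ) = i + 1 then cutoff d (fun k => u k t) j else 0)
      - (if (i : ℕ) = j + 1 then cutoff d (fun k => u k t) i else 0) := by
  simp only [laxM, Matrix.sum_apply, Matrix.smul_apply, Matrix.sub_apply, smul_eq_mul,
    mul_sub, Finset.sum_sub_distrib]
  rw [sum_Icc_mul_eq_cutoff (fun k => u k t) _ j ((j : ℕ) = i + 1),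
    sum_Icc_mul_eq_cutoff (fun k => u k t) _ i ((i : ℕ) = j + 1)]
  all_goals
    intro k hk
    rw [Finset.mem_Icc] at hk
    rw [elemE_apply (by omega) (by omega)]
    congr 1
    apply propext
    omega

theorem laxM_transpose (d : ℕ) (u : ℕ → ℝ → ℝ) (t : ℝ) : (laxM d u t).transpose = -laxM d u t := by
  ext i j
  simp only [Matrix.transpose_apply, Matrix.neg_apply, laxM_apply]
  ring

theorem laxL_transpose (d : ℕ) (s r : ℕ → ℝ → ℝ) (t : ℝ) :
    (laxL d s r t).transpose = laxL d s r t := by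
  ext i j
  simp only [Matrix.transpose_apply, laxL_apply]
  exact jacobiEntry_comm _ _ _ _

theorem laxM_mul_apply (d : ℕ) (u : ℕ → ℝ → ℝ) (t : ℝ)
    (A : Matrix (Fin (d + 1)) (Fin (d + 1)) ℝ) (f : ℕ → ℕ → ℝ)
    (hA : ∀ i j : Fin (d + 1), A i j = f i j) (i j : Fin (d + 1)) :
    (laxM d u t * A) i j = cutoff d (fun k => u k t) (i + 1) * f (i + 1) j
      - cutoff d (fun k => u k t) i * f (i - 1) j := by
  set v := cutoff d fun k => u k t with hv
  have hsum : (laxM d u t * A) i j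
      = ∑ k ∈ Finset.range (d + 1), ((if k = i + 1 then v k else 0)
        - (if (i : ℕ) = k + 1 then v i else 0)) * f k j := by
    rw [← Fin.sum_univ_eq_sum_range (fun k => ((if k = i + 1 then v k else 0)
        - (if (i : ℕ) = k + 1 then v i else 0)) * f k j), Matrix.mul_apply]
    exact Finset.sum_congr rfl fun k _ => by rw [laxM_apply, hA]
  rw [hsum]
  simp only [sub_mul, Finset.sum_sub_distrib]
  congr 1
  · rw [Finset.sum_eq_single (i + 1 : ℕ)]
    · simp
    · intro k _ hk
      simp [hk]
    · intro hi
      rw [hv, cutoff_of_notMem _ (by simp at hi ⊢; omega)]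
      simp
  · rcases Nat.eq_zero_or_pos (i : ℕ) with hi | hi
    · simp [hi, hv, cutoff_zero]
    · rw [Finset.sum_eq_single (i - 1 : ℕ)]
      · rw [if_pos (by omega)]
      · intro k _ hk
        rw [if_neg (by omega), zero_mul]
      · intro hk
        exact absurd (Finset.mem_range.2 (by omega)) hk

/-- The entries of the commutator `[M, L]`, written through the antisymmetry of `M` and the
symmetry of `L`. -/
theorem commutator_apply (d : ℕ) (s r u : ℕ → ℝ → ℝ) (t : ℝ) (i j : Fin (d + 1)) :
    (laxM d u t * laxL d s r t - laxL d s r t * laxM d u t) i j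
      = (laxM d u t * laxL d s r t) i j + (laxM d u t * laxL d s r t) j i := by
  have h : laxL d s r t * laxM d u t = -(laxM d u t * laxL d s r t).transpose := by
    rw [Matrix.transpose_mul, laxM_transpose, laxL_transpose, mul_neg, neg_neg]
  rw [h, sub_neg_eq_add, Matrix.add_apply, Matrix.transpose_apply]

theorem jacobiEntry_self (a b : ℕ → ℝ) (i : ℕ) : jacobiEntry a b i i = a (i + 1) - a i := by
  simp [jacobiEntry]

theorem jacobiEntry_succ_right (a b : ℕ → ℝ) (i : ℕ) : jacobiEntry a b i (i + 1) = b (i + 1) := by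
  simp [jacobiEntry]
  omega

theorem jacobiEntry_succ_left (a b : ℕ → ℝ) (i : ℕ) : jacobiEntry a b (i + 1) i = b (i + 1) := by
  rw [jacobiEntry_comm, jacobiEntry_succ_right]

theorem jacobiEntry_of_lt (a b : ℕ → ℝ) {i j : ℕ} (h : i + 1 < j) : jacobiEntry a b i j = 0 := by
  simp only [jacobiEntry]
  rw [if_neg (by omega), if_neg (by omega), if_neg (by omega), add_zero, add_zero]

theorem jacobiEntry_of_gt (a b : ℕ → ℝ) {i j : ℕ} (h : j + 1 < i) : jacobiEntry a b i j = 0 := by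
  rw [jacobiEntry_comm, jacobiEntry_of_lt a b h]

/-- The entry `(i, j)` of the product of the antisymmetric tridiagonal matrix with upper
off-diagonal `v` and the symmetric one given by `jacobiEntry a b`. -/
noncomputable def skewMulEntry (v a b : ℕ → ℝ) (i j : ℕ) : ℝ :=
  v (i + 1) * jacobiEntry a b (i + 1) j - v i * jacobiEntry a b (i - 1) j

theorem skewMulEntry_self {v : ℕ → ℝ} (a b : ℕ → ℝ) (hv : v 0 = 0) (i : ℕ) :
    skewMulEntry v a b i i = v (i + 1) * b (i + 1) - v i * b i := by
  rcases i with _ | i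
  · simp [skewMulEntry, hv, jacobiEntry_succ_left]
  · simp [skewMulEntry, jacobiEntry_succ_left, jacobiEntry_succ_right]

theorem skewMulEntry_succ_right {v : ℕ → ℝ} (a b : ℕ → ℝ) (hv : v 0 = 0) (i : ℕ) :
    skewMulEntry v a b i (i + 1) = v (i + 1) * (a (i + 2) - a (i + 1)) := by
  rcases i with _ | i
  · simp [skewMulEntry, hv, jacobiEntry_self]
  · simp [skewMulEntry, jacobiEntry_self, jacobiEntry_of_lt]

theorem skewMulEntry_succ_left (v a b : ℕ → ℝ) (i : ℕ) :
    skewMulEntry v a b (i + 1) i = -(v (i + 1) * (a (i + 1) - a i)) := by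
  simp [skewMulEntry, jacobiEntry_self, jacobiEntry_of_gt]

theorem skewMulEntry_add_two_right {v : ℕ → ℝ} (a b : ℕ → ℝ) (hv : v 0 = 0) (i : ℕ) :
    skewMulEntry v a b i (i + 2) = v (i + 1) * b (i + 2) := by
  rcases i with _ | i
  · simp [skewMulEntry, hv, jacobiEntry_succ_right]
  · simp [skewMulEntry, jacobiEntry_succ_right, jacobiEntry_of_lt]

theorem skewMulEntry_add_two_left (v a b : ℕ → ℝ) (i : ℕ) :
    skewMulEntry v a b (i + 2) i = -(v (i + 2) * b (i + 1)) := by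
  simp [skewMulEntry, jacobiEntry_succ_left, jacobiEntry_of_gt]

theorem skewMulEntry_of_lt (v a b : ℕ → ℝ) {i j : ℕ} (h : i + 2 < j) :
    skewMulEntry v a b i j = 0 := by
  rw [skewMulEntry, jacobiEntry_of_lt _ _ (by omega), jacobiEntry_of_lt _ _ (by omega)]
  ring

theorem skewMulEntry_of_gt (v a b : ℕ → ℝ) {i j : ℕ} (h : j + 2 < i) :
    skewMulEntry v a b i j = 0 := by
  rw [skewMulEntry, jacobiEntry_of_gt _ _ (by omega), jacobiEntry_of_gt _ _ (by omega)]
  ring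

/-- Entrywise comparison of a symmetric tridiagonal matrix with the symmetrized product of an
antisymmetric and a symmetric one. -/
theorem jacobiEntry_eq_iff (d : ℕ) {v a b a' b' : ℕ → ℝ} (hv : v 0 = 0)
    (hb : b (d + 1) = 0) (ha' : a' 0 = 0) (had : a' (d + 1) = 0)
    (hvb : ∀ k, 1 ≤ k → k + 1 ≤ d → v k * b (k + 1) = v (k + 1) * b k) :
    (∀ i j, i ≤ d → j ≤ d →
      jacobiEntry a' b' i j = skewMulEntry v a b i j + skewMulEntry v a b j i)
    ↔ ∀ k, 1 ≤ k → k ≤ d →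
      a' k = 2 * b k * v k ∧ b' k = v k * (a (k - 1) - 2 * a k + a (k + 1)) := by
  constructor
  · intro h k hk hkd
    refine ⟨?_, ?_⟩
    · clear hk
      induction k with
      | zero => rw [ha', hv, mul_zero]
      | succ k ih =>
        have hdiag := h k k (by omega) (by omega)
        rw [jacobiEntry_self, skewMulEntry_self a b hv] at hdiag
        linarith [ih (by omega)]
    · obtain ⟨k, rfl⟩ := Nat.exists_eq_add_of_le' hk
      have hoff := h k (k + 1) (by omega) hkd
      rw [jacobiEntry_succ_right, skewMulEntry_succ_right a b hv, skewMulEntry_succ_left] at hoff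
      rw [hoff, Nat.add_sub_cancel]
      ring
  · intro h
    have ha (k : ℕ) (hk : k ≤ d + 1) : a' k = 2 * b k * v k := by
      rcases Nat.eq_zero_or_pos k with rfl | hpos
      · rw [ha', hv, mul_zero]
      rcases Nat.lt_or_ge d k with hlt | hle
      · obtain rfl : k = d + 1 := by omega
        rw [had, hb, mul_zero, zero_mul]
      · exact (h k hpos hle).1
    intro i j hi hj
    wlog hij : i ≤ j generalizing i j
    · rw [jacobiEntry_comm, add_comm]
      exact this j i hj hi (by omega)
    obtain rfl | rfl | rfl | hlt : j = i ∨ j = i + 1 ∨ j = i + 2 ∨ i + 2 < j := by omega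
    · rw [jacobiEntry_self, skewMulEntry_self a b hv, ha _ (by omega), ha _ (by omega)]
      ring
    · rw [jacobiEntry_succ_right, skewMulEntry_succ_right a b hv, skewMulEntry_succ_left,
        (h (i + 1) (by omega) hj).2, Nat.add_sub_cancel]
      ring
    · rw [jacobiEntry_of_lt _ _ (by omega), skewMulEntry_add_two_right a b hv,
        skewMulEntry_add_two_left, hvb (i + 1) (by omega) hj]
      ring
    · rw [jacobiEntry_of_lt _ _ (by omega), skewMulEntry_of_lt v a b hlt,
        skewMulEntry_of_gt v a b hlt, add_zero]

/-- the Lax equation L̇ = [M, L] in 𝔰𝔩(d+1,ℝ) is equivalent to the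
coupled system ṡ_i = 2 r_i u_i, ṙ_i = u_i (s_{i−1} − 2 s_i + s_{i+1}) with the
convention s_0 = s_{d+1} = 0. -/
theorem stmt_15 (d : ℕ) (hd : 1 ≤ d) (s r u s' r' : ℕ → ℝ → ℝ)
    (hs0 : ∀ t, s 0 t = 0) (hsd1 : ∀ t, s (d + 1) t = 0)
    (hsderiv : ∀ i ∈ Finset.Icc 1 d, ∀ t ∈ Set.Ici (0 : ℝ), HasDerivAt (s i) (s' i t) t)
    (hrderiv : ∀ i ∈ Finset.Icc 1 d, ∀ t ∈ Set.Ici (0 : ℝ), HasDerivAt (r i) (r' i t) t)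
    (hucont : ∀ i ∈ Finset.Icc 1 d, ContinuousOn (u i) (Set.Ici (0 : ℝ)))
    (hune : ∀ i ∈ Finset.Icc 1 d, ∀ t ∈ Set.Ici (0 : ℝ), u i t ≠ 0)
    (hrne : ∀ i ∈ Finset.Icc 1 d, ∀ t ∈ Set.Ici (0 : ℝ), r i t ≠ 0)
    (hratio : ∀ i ∈ Finset.Icc 2 d, ∀ t ∈ Set.Ici (0 : ℝ),
      r (i - 1) t / r i t = u (i - 1) t / u i t) :
    (∀ t ∈ Set.Ici (0 : ℝ),
      ((∑ i ∈ Finset.Icc 1 d, s' i t • (elemE d (i - 1) (i - 1) - elemE d i i))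
          + ∑ i ∈ Finset.Icc 1 d, r' i t • (elemE d (i - 1) i + elemE d i (i - 1)))
        = laxM d u t * laxL d s r t - laxL d s r t * laxM d u t)
    ↔ (∀ t ∈ Set.Ici (0 : ℝ), ∀ i ∈ Finset.Icc 1 d,
        s' i t = 2 * r i t * u i t ∧
        r' i t = u i t * (s (i - 1) t - 2 * s i t + s (i + 1) t)) := by
  refine forall₂_congr fun t ht => ?_
  have hmem (k : ℕ) : k ∈ Finset.Icc 1 d ↔ 1 ≤ k ∧ k ≤ d := Finset.mem_Icc
  have hcut (x : ℕ → ℝ) {k : ℕ} (h1 : 1 ≤ k) (h2 : k ≤ d) : cutoff d x k = x k :=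
    cutoff_of_mem x ((hmem k).2 ⟨h1, h2⟩)
  have hend (x : ℕ → ℝ) : cutoff d x (d + 1) = 0 := cutoff_of_notMem x (by simp)
  have hs (k : ℕ) (hk : k ≤ d + 1) : cutoff d (fun k => s k t) k = s k t := by
    rcases Nat.eq_zero_or_pos k with rfl | hpos
    · rw [cutoff_zero, hs0]
    rcases Nat.lt_or_ge d k with hlt | hle
    · obtain rfl : k = d + 1 := by omega
      rw [hend, hsd1]
    · exact hcut _ hpos hle
  have hmul := laxM_mul_apply d u t _ _ (laxL_apply d s r t)
  have hratio' (k : ℕ) (h1 : 1 ≤ k) (h2 : k + 1 ≤ d) :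
      cutoff d (fun k => u k t) k * cutoff d (fun k => r k t) (k + 1)
        = cutoff d (fun k => u k t) (k + 1) * cutoff d (fun k => r k t) k := by
    rw [hcut _ h1 (by omega), hcut _ h1 (by omega), hcut _ (by omega) h2, hcut _ (by omega) h2]
    have hk := hratio (k + 1) (by simp; omega) t ht
    have hmem' : k + 1 ∈ Finset.Icc 1 d := (hmem _).2 ⟨by omega, h2⟩
    rw [Nat.add_sub_cancel, div_eq_div_iff (hrne _ hmem' t ht) (hune _ hmem' t ht)] at hk
    linarith
  have key := jacobiEntry_eq_iff d (a := cutoff d fun k => s k t) (a' := cutoff d fun k => s' k t)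
    (b' := cutoff d fun k => r' k t) (cutoff_zero d fun k => u k t) (hend fun k => r k t)
    (cutoff_zero d _) (hend _) hratio'
  constructor
  · intro h k hk
    obtain ⟨h1, h2⟩ := (hmem k).1 hk
    have := key.1 (fun i j hi hj => ?_) k h1 h2
    · simpa only [hcut _ h1 h2, hs (k - 1) (by omega), hs k (by omega), hs (k + 1) (by omega)]
        using this
    · have hij := congrFun₂ h ⟨i, Nat.lt_succ_of_le hi⟩ ⟨j, Nat.lt_succ_of_le hj⟩
      rwa [sum_smul_elemE_apply, commutator_apply, hmul, hmul] at hij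
  · intro h
    ext i j
    rw [sum_smul_elemE_apply, commutator_apply, hmul, hmul]
    refine key.2 (fun k h1 h2 => ?_) i j (Nat.le_of_lt_succ i.2) (Nat.le_of_lt_succ j.2)
    simpa only [hcut _ h1 h2, hs (k - 1) (by omega), hs k (by omega), hs (k + 1) (by omega)]
      using h k ((hmem k).2 ⟨h1, h2⟩)
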